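/- arXiv:1803.04555 — 3 statements merged into one kernel-verified Lean document; each statement's English description precedes it below -/
import Mathlib

section
/- Let G be a simple graph on a finite vertex set V with a symmetric nonnegative edge-weight function w and weighted shortest-path distance d, and let V be partitioned into pairwise disjoint sets A, S, B such that no edge of G joins a vertex of A to a vertex of B. Then for every q ∈ A and every p ∈ B, d(q,p) = ⨅_{s ∈ S} (d(q,s) + d(s,p)) (both sides being ∞ when S is empty or no such path exists). -/
open scoped ENNReal

/-- The total weight of a walk: the sum, over the edges (darts) of the walk,
of their weights. -/
noncomputable def walkWeight {V : Type*} {G : SimpleGraph V} (w : V → V → ℝ≥0∞)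
    {u v : V} (p : G.Walk u v) : ℝ≥0∞ :=
  (p.darts.map (fun d => w d.toProd.1 d.toProd.2)).sum

/-- The weighted shortest-path distance: the infimum in `ℝ≥0∞` over all walks
from `u` to `v` of their total weight (`∞` if no walk exists). -/
noncomputable def gdist {V : Type*} (G : SimpleGraph V) (w : V → V → ℝ≥0∞)
    (u v : V) : ℝ≥0∞ :=
  ⨅ p : G.Walk u v, walkWeight w p

theorem walkWeight_append {V : Type*} {G : SimpleGraph V} (w : V → V → ℝ≥0∞)
    {u v x : V} (r : G.Walk u v) (t : G.Walk v x) :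
    walkWeight w (r.append t) = walkWeight w r + walkWeight w t := by
  simp [walkWeight, SimpleGraph.Walk.darts_append]

/-- The weighted distance satisfies the triangle inequality. -/
theorem gdist_triangle {V : Type*} (G : SimpleGraph V) (w : V → V → ℝ≥0∞) (u v x : V) :
    gdist G w u x ≤ gdist G w u v + gdist G w v x :=
  ENNReal.le_iInf_add_iInf fun r t =>
    (iInf_le _ (r.append t)).trans_eq (walkWeight_append w r t)

/-- A walk between the two sides of a separation meets the separator. -/
theorem exists_mem_support_of_separation {V : Type*} {G : SimpleGraph V} {A S B : Set V}
    (hAB : Disjoint A B) (hcover : A ∪ S ∪ B = Set.univ)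
    (hsep : ∀ a ∈ A, ∀ b ∈ B, ¬ G.Adj a b) {q p : V} (r : G.Walk q p)
    (hq : q ∈ A) (hp : p ∈ B) : ∃ s ∈ S, s ∈ r.support := by
  induction r with
  | nil => exact (Set.disjoint_left.mp hAB hq hp).elim
  | @cons u v x h r ih =>
    have hv : v ∈ A ∪ S ∪ B := hcover ▸ Set.mem_univ v
    rcases hv with (hv | hv) | hv
    · obtain ⟨s, hs, hsr⟩ := ih hv hp
      exact ⟨s, hs, by simp [hsr]⟩
    · exact ⟨v, hv, by simp⟩
    · exact (hsep u hq v hv h).elim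

/-- If the vertex set of a finite weighted simple graph `G` is
partitioned into pairwise disjoint sets `A`, `S`, `B` with no edge joining `A`
to `B`, then for every `q ∈ A` and `p ∈ B`,
`d(q,p) = ⨅ s ∈ S, (d(q,s) + d(s,p))`. -/
theorem gdist_eq_iInf_through_separator {V : Type*} [Fintype V]
    (G : SimpleGraph V) (w : V → V → ℝ≥0∞)
    (hsymm : ∀ u v, w u v = w v u)
    (A S B : Set V)
    (hAS : Disjoint A S) (hAB : Disjoint A B) (hSB : Disjoint S B)
    (hcover : A ∪ S ∪ B = Set.univ)
    (hsep : ∀ a ∈ A, ∀ b ∈ B, ¬ G.Adj a b)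
    (q p : V) (hq : q ∈ A) (hp : p ∈ B) :
    gdist G w q p = ⨅ s ∈ S, (gdist G w q s + gdist G w s p) := by
  classical
  refine le_antisymm (le_iInf₂ fun s _ => gdist_triangle G w q s p) (le_iInf fun r => ?_)
  obtain ⟨s, hs, hsr⟩ := exists_mem_support_of_separation hAB hcover hsep r hq hp
  calc ⨅ s ∈ S, (gdist G w q s + gdist G w s p)
      ≤ gdist G w q s + gdist G w s p := iInf₂_le s hs
    _ ≤ walkWeight w (r.takeUntil s hsr) + walkWeight w (r.dropUntil s hsr) :=
      add_le_add (iInf_le _ _) (iInf_le _ _)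
    _ = walkWeight w r := by rw [← walkWeight_append, r.take_spec hsr]
end

section
/- Let G be a directed graph on a finite vertex set V with a nonnegative arc-weight function w and weighted shortest-path distance d (the infimum in ℝ≥0∞ over directed walks of the sum of arc weights), let V be partitioned into pairwise disjoint sets A, S, B such that no arc of G joins a vertex of A and a vertex of B in either direction, and let P ⊆ V be a set of sites. Then for every q ∈ A, ⨅_{p ∈ P} d(q,p) = min( ⨅_{p ∈ P ∩ A} d_A(q,p) , ⨅_{s ∈ S} ( d(q,s) + ⨅_{p ∈ P} d(s,p) ) ), where d_A denotes the weighted shortest-path distance in the directed subgraph induced on A. -/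
open scoped ENNReal

/-- The weighted shortest-path distance in a directed graph with arc relation `E`
and arc weights `w`: the infimum in `ℝ≥0∞`, over all directed walks from `u` to `v`
(encoded as a list `u :: l` of consecutively `E`-related vertices ending at `v`),
of the sum of the weights of their arcs (`∞` if no directed walk exists). -/
noncomputable def ddist {V : Type*} (E : V → V → Prop) (w : V → V → ℝ≥0∞)
    (u v : V) : ℝ≥0∞ :=
  ⨅ (l : List V) (_ : List.Chain E u l) (_ : (u :: l).getLast? = some v),
    (((u :: l).zip l).map (fun p => w p.1 p.2)).sum

section Distance

variable {V : Type*} {E : V → V → Prop} {w : V → V → ℝ≥0∞}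

theorem ddist_self (u : V) : ddist E w u u = 0 := by
  have h : ddist E w u u ≤ 0 :=
    (iInf_le _ []).trans <| (iInf_le _ (List.IsChain.singleton u)).trans <|
      (iInf_le _ rfl).trans (by simp)
  exact le_antisymm h zero_le

theorem ddist_le_weight_add {u v : V} (h : E u v) (t : V) :
    ddist E w u t ≤ w u v + ddist E w v t := by
  rw [← tsub_le_iff_left]
  refine le_iInf fun l => le_iInf fun hl => le_iInf fun ht => ?_
  rw [tsub_le_iff_left]
  refine (iInf_le _ (v :: l)).trans <| (iInf_le _ (List.IsChain.cons_cons h hl)).trans <|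
    (iInf_le _ ?_).trans (by simp)
  rwa [List.getLast?_cons_cons]

/-- A function that drops by at most the weight of each arc drops by at most the distance. -/
theorem le_ddist_add_of_forall_arc {f : V → ℝ≥0∞}
    (hf : ∀ u v, E u v → f u ≤ w u v + f v) (u t : V) :
    f u ≤ ddist E w u t + f t := by
  rw [← tsub_le_iff_right]
  refine le_iInf fun l => le_iInf fun hl => le_iInf fun ht => ?_
  rw [tsub_le_iff_right]
  induction l generalizing u with
  | nil =>
    obtain rfl : u = t := by simpa using ht
    simp
  | cons v l ih =>
    obtain ⟨huv, hl⟩ := List.isChain_cons_cons.mp hl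
    rw [List.getLast?_cons_cons] at ht
    calc f u ≤ w u v + f v := hf u v huv
      _ ≤ w u v + ((((v :: l).zip l).map fun p => w p.1 p.2).sum + f t) := by
        gcongr
        exact ih v hl ht
      _ = _ := by simp [add_assoc]

theorem ddist_le_weight {u v : V} (h : E u v) : ddist E w u v ≤ w u v := by
  simpa [ddist_self] using ddist_le_weight_add (w := w) h v

theorem iInf_ddist_le_weight_add (P : Set V) {u v : V} (h : E u v) :
    (⨅ p ∈ P, ddist E w u p) ≤ w u v + ⨅ p ∈ P, ddist E w v p := by
  rw [← tsub_le_iff_left]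
  refine le_iInf₂ fun p hp => ?_
  rw [tsub_le_iff_left]
  exact (iInf₂_le p hp).trans (ddist_le_weight_add h p)

theorem ddist_le_ddist_induced (A : Set V) (u t : A) :
    ddist E w u t ≤ ddist (fun a b : A => E a.val b.val) (fun a b : A => w a.val b.val) u t := by
  simpa [ddist_self] using
    le_ddist_add_of_forall_arc (E := fun a b : A => E a.val b.val)
      (w := fun a b : A => w a.val b.val) (f := fun a : A => ddist E w a t)
      (fun _ _ h => ddist_le_weight_add h _) u t

end Distance

/-- Let `A, S, B` be a separation of a finite weighted directed
graph (no arc joins `A` and `B` in either direction) and let `P` be a set of sites.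
Then for every `q ∈ A`, the distance from `q` to the nearest site equals the minimum
of (a) the distance, within the directed subgraph induced on `A`, from `q` to the
nearest site in `P ∩ A`, and (b) the minimum over separator vertices `s` of `d(q,s)`
plus the distance from `s` to its nearest site. -/
theorem nearest_site_via_separator_directed {V : Type*} [Fintype V]
    (E : V → V → Prop) (w : V → V → ℝ≥0∞)
    (A S B : Set V)
    (hAS : Disjoint A S) (hAB : Disjoint A B) (hSB : Disjoint S B)
    (hcover : A ∪ S ∪ B = Set.univ)
    (hsep : ∀ a ∈ A, ∀ b ∈ B, ¬ E a b ∧ ¬ E b a)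
    (P : Set V)
    (q : V) (hq : q ∈ A) :
    (⨅ p ∈ P, ddist E w q p)
      = min
          (⨅ (p : V) (hp : p ∈ P ∩ A),
            ddist (fun a b : A => E a.val b.val) (fun a b : A => w a.val b.val)
              ⟨q, hq⟩ ⟨p, hp.2⟩)
          (⨅ s ∈ S, (ddist E w q s + ⨅ p ∈ P, ddist E w s p)) := by
  classical
  let g : V → ℝ≥0∞ := fun v => ⨅ p ∈ P, ddist E w v p
  let r : A → ℝ≥0∞ := fun v => min
    (⨅ (p : V) (hp : p ∈ P ∩ A),
      ddist (fun a b : A => E a.val b.val) (fun a b : A => w a.val b.val) v ⟨p, hp.2⟩)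
    (⨅ s ∈ S, (ddist E w v s + g s))
  have g_step : ∀ u v, E u v → g u ≤ w u v + g v := fun u v => iInf_ddist_le_weight_add P
  have g_le_r : ∀ v : A, g v ≤ r v := fun v =>
    le_min
      (le_iInf₂ fun p hp => (iInf₂_le p hp.1).trans (ddist_le_ddist_induced A v ⟨p, hp.2⟩))
      (le_iInf₂ fun s _ => le_ddist_add_of_forall_arc g_step v s)
  have r_step : ∀ u v : A, E u v → r u ≤ w u v + r v := by
    intro u v h
    rw [← tsub_le_iff_left]
    refine le_min (le_iInf₂ fun p hp => ?_) (le_iInf₂ fun s hs => ?_) <;> rw [tsub_le_iff_left]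
    · exact (min_le_left _ _).trans <| (iInf₂_le p hp).trans <|
        ddist_le_weight_add (E := fun a b : A => E a.val b.val)
          (w := fun a b : A => w a.val b.val) h _
    · rw [← add_assoc]
      refine (min_le_right _ _).trans <| (iInf₂_le s hs).trans ?_
      gcongr
      exact ddist_le_weight_add h s
  change g q = r ⟨q, hq⟩
  refine le_antisymm (g_le_r ⟨q, hq⟩) (le_iInf₂ fun p hp => ?_)
  let f : V → ℝ≥0∞ := fun v => if hv : v ∈ A then r ⟨v, hv⟩ else g v
  have f_of_mem : ∀ {v} (hv : v ∈ A), f v = r ⟨v, hv⟩ := fun hv => dif_pos hv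
  have f_of_notMem : ∀ {v}, v ∉ A → f v = g v := fun hv => dif_neg hv
  have g_le_f : ∀ v, g v ≤ f v := by
    intro v
    by_cases hv : v ∈ A
    · exact (g_le_r ⟨v, hv⟩).trans_eq (f_of_mem hv).symm
    · exact (f_of_notMem hv).ge
  have f_step : ∀ u v, E u v → f u ≤ w u v + f v := by
    intro u v h
    by_cases hu : u ∈ A
    · by_cases hv : v ∈ A
      · rw [f_of_mem hu, f_of_mem hv]
        exact r_step ⟨u, hu⟩ ⟨v, hv⟩ h
      · have hvS : v ∈ S := by
          rcases hcover.symm ▸ Set.mem_univ v with (hvA | hvS) | hvB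
          · exact absurd hvA hv
          · exact hvS
          · exact absurd h (hsep u hu v hvB).1
        rw [f_of_mem hu, f_of_notMem hv]
        refine (min_le_right _ _).trans <| (iInf₂_le v hvS).trans ?_
        gcongr
        exact ddist_le_weight h
    · rw [f_of_notMem hu]
      exact (g_step u v h).trans (by gcongr; exact g_le_f v)
  have f_site : f p = 0 := by
    refine le_antisymm ?_ zero_le
    by_cases hpA : p ∈ A
    · rw [f_of_mem hpA]
      exact (min_le_left _ _).trans <| (iInf₂_le p ⟨hp, hpA⟩).trans (ddist_self _).le
    · rw [f_of_notMem hpA]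
      exact (iInf₂_le p hp).trans (ddist_self p).le
  simpa [f_site, f_of_mem hq] using le_ddist_add_of_forall_arc f_step q p
end

section
/- Let X be a finite set of even cardinality and let d : X × X → ℝ be a symmetric function such that the values d(p,q) over unordered pairs of distinct elements p ≠ q are pairwise distinct. Let M be the perfect matching on X produced by the greedy algorithm that repeatedly selects an unordered pair {p,q} of distinct remaining elements minimizing d(p,q), matches p with q, and removes both from consideration. Then M is stable: there is no pair of distinct elements p, q with {p,q} ∉ M such that d(p,q) < d(p, M(p)) and d(p,q) < d(q, M(q)), where M(r) denotes the element matched to r. -/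
/-- `GreedyMatching d s M` holds when `M` is a matching (a set of unordered pairs)
that the greedy algorithm can produce starting from the set `s` of remaining
elements: it repeatedly selects an unordered pair `{p, q}` of distinct remaining
elements minimizing `d p q`, matches `p` with `q`, and removes both from
consideration, until no elements remain. -/
inductive GreedyMatching {X : Type*} [DecidableEq X] (d : X → X → ℝ) :
    Finset X → Finset (Sym2 X) → Prop
  | empty : GreedyMatching d ∅ ∅
  | step (s : Finset X) (M : Finset (Sym2 X)) (p q : X)
      (hp : p ∈ s) (hq : q ∈ s) (hpq : p ≠ q)
      (hmin : ∀ a ∈ s, ∀ b ∈ s, a ≠ b → d p q ≤ d a b)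
      (hrest : GreedyMatching d ((s.erase p).erase q) M) :
      GreedyMatching d s (insert s(p, q) M)

/-- A matching produced greedily from `s` only involves elements of `s`. -/
theorem GreedyMatching.mem_of_mem {X : Type*} [DecidableEq X] {d : X → X → ℝ}
    {s : Finset X} {M : Finset (Sym2 X)} (hM : GreedyMatching d s M)
    {e : Sym2 X} (he : e ∈ M) {r : X} (hr : r ∈ e) : r ∈ s := by
  induction hM with
  | empty => simp at he
  | step s M x y hx hy _ _ _ ih =>
    rcases Finset.mem_insert.1 he with rfl | he
    · rcases Sym2.mem_iff.1 hr with rfl | rfl <;> assumption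
    · exact Finset.mem_of_mem_erase (Finset.mem_of_mem_erase (ih he))

/-- In a matching produced greedily for a symmetric `d`, any two distinct matched elements are
at least as far apart as one of them is from its partner. -/
theorem GreedyMatching.le_or_le {X : Type*} [DecidableEq X] {d : X → X → ℝ}
    (hsymm : ∀ p q : X, d p q = d q p) {s : Finset X} {M : Finset (Sym2 X)}
    (hM : GreedyMatching d s M) {p q p' q' : X} (hpq : p ≠ q)
    (hp : s(p, p') ∈ M) (hq : s(q, q') ∈ M) : d p p' ≤ d p q ∨ d q q' ≤ d p q := by
  induction hM with
  | empty => simp at hp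
  | step s M x y hx hy hxy hmin hrest ih =>
    have hM := GreedyMatching.step s M x y hx hy hxy hmin hrest
    have hle : d x y ≤ d p q :=
      hmin p (hM.mem_of_mem hp (Sym2.mem_mk_left p p')) q
        (hM.mem_of_mem hq (Sym2.mem_mk_left q q')) hpq
    have heq {a b : X} (h : s(a, b) = s(x, y)) : d a b = d x y := by
      rcases Sym2.eq_iff.1 h with ⟨rfl, rfl⟩ | ⟨rfl, rfl⟩
      · rfl
      · exact hsymm _ _
    rcases Finset.mem_insert.1 hp with h | hp
    · exact Or.inl ((heq h).trans_le hle)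
    rcases Finset.mem_insert.1 hq with h | hq
    · exact Or.inr ((heq h).trans_le hle)
    exact ih hp hq

/-- Let `X` be a finite set of even cardinality and `d` a
symmetric function whose values on distinct unordered pairs are pairwise distinct.
If `M` is the perfect matching on `X` produced by the greedy algorithm that
repeatedly matches and removes a closest pair, then `M` is stable: there is no
pair of distinct elements `p, q` with `{p,q} ∉ M` such that `d(p,q) < d(p, M(p))`
and `d(p,q) < d(q, M(q))`, where `M(r)` denotes the element matched to `r`. -/
theorem greedy_matching_is_stable {X : Type*} [Fintype X] [DecidableEq X]
    (heven : Even (Fintype.card X))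
    (d : X → X → ℝ)
    (hsymm : ∀ p q : X, d p q = d q p)
    (hdistinct : ∀ p q a b : X, p ≠ q → a ≠ b → s(p, q) ≠ s(a, b) →
      d p q ≠ d a b)
    (M : Finset (Sym2 X))
    (hM : GreedyMatching d Finset.univ M) :
    ∀ p q : X, p ≠ q → s(p, q) ∉ M →
      ∀ p' q' : X, s(p, p') ∈ M → s(q, q') ∈ M →
        ¬ (d p q < d p p' ∧ d p q < d q q') := by
  intro p q hpq _ p' q' hp hq ⟨h₁, h₂⟩
  rcases hM.le_or_le hsymm hpq hp hq with h | h
  · exact h.not_gt h₁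
  · exact h.not_gt h₂
end
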